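/- For every integer n ≥ 1, every integer j with 0 ≤ j ≤ n−1, and every z ∈ ℂ, the squared norms of consecutive Veronese sections satisfy (1+|z|²)²·‖V̂_{j+1}ⁿ(z)‖² = (j+1)(n−j)·‖V̂ⱼⁿ(z)‖²; equivalently, the function γⱼⁿ(z) = ‖V̂_{j+1}ⁿ(z)‖²/‖V̂ⱼⁿ(z)‖² equals (j+1)(n−j)/(1+|z|²)². -/

import Mathlib

open Complex Finset

/-- The `j`-th Veronese section `V̂ⱼⁿ : ℂ → ℂ^{n+1}`, whose `r`-th component is
`f_{j,r}(z) = (j!/(1+|z|²)^j)·√(binom n r)·Σ_{k=0}^{j} (−1)^k·binom r (j−k)·binom (n−r) k·z^{r−j+k}·conj(z)^k`. -/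
noncomputable def veroneseSection (n j : ℕ) (z : ℂ) : Fin (n + 1) → ℂ :=
  fun r =>
    ((j.factorial : ℂ) / (1 + (Complex.normSq z : ℂ)) ^ j) *
      (Real.sqrt (n.choose (r : ℕ)) : ℂ) *
      ∑ k ∈ Finset.range (j + 1),
        (-1 : ℂ) ^ k * ((r : ℕ).choose (j - k) : ℂ) * ((n - (r : ℕ)).choose k : ℂ) *
          z ^ ((r : ℕ) - (j - k)) * ((starRingEnd ℂ) z) ^ k

section Krawtchouk

variable {R : Type*} [CommRing R]

theorem coeff_one_add_C_mul_X_pow (a : R) (n k : ℕ) :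
    ((1 + Polynomial.C a * Polynomial.X) ^ n).coeff k = n.choose k * a ^ k := by
  have h : (1 + Polynomial.C a * Polynomial.X) ^ n =
      ((1 + Polynomial.X : Polynomial R) ^ n).comp (Polynomial.C a * Polynomial.X) := by
    simp
  rw [h, Polynomial.comp_C_mul_X_coeff, Polynomial.coeff_one_add_X_pow]

/-- The generating polynomial of the unnormalised `r`-th components of the Veronese sections. -/
noncomputable def veroneseGen (a b : R) (n r : ℕ) : Polynomial R :=
  (1 + Polynomial.C (-b) * Polynomial.X) ^ (n - r) * (Polynomial.X + Polynomial.C a) ^ r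

theorem veroneseGen_coeff (a b : R) (n r j : ℕ) :
    (veroneseGen a b n r).coeff j =
      ∑ k ∈ range (j + 1), (-1) ^ k * (r.choose (j - k) : R) * ((n - r).choose k : R) *
        a ^ (r - (j - k)) * b ^ k := by
  rw [veroneseGen, Polynomial.coeff_mul, Finset.Nat.sum_antidiagonal_eq_sum_range_succ_mk]
  refine sum_congr rfl fun k _ => ?_
  rw [coeff_one_add_C_mul_X_pow, Polynomial.coeff_X_add_C_pow, neg_pow]
  ring

/-- The bivariate generating identity, read off at the monomial `tʲ sʲ`. -/
theorem sum_choose_mul_veroneseGen_coeff (a b : R) (n j : ℕ) :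
    ∑ r ∈ range (n + 1),
        (n.choose r : R) * ((veroneseGen a b n r).coeff j * (veroneseGen b a n r).coeff j) =
      (1 + a * b) ^ n * n.choose j := by
  have key : ∑ r ∈ range (n + 1), (n.choose r : Polynomial (Polynomial R)) *
        (Polynomial.C (veroneseGen a b n r) * (veroneseGen b a n r).map Polynomial.C) =
      Polynomial.C (Polynomial.C ((1 + a * b) ^ n)) *
        (1 + Polynomial.C Polynomial.X * Polynomial.X) ^ n := by
    rw [map_pow, map_pow, ← mul_pow]
    have h : (Polynomial.C (Polynomial.C (1 + a * b)) *
          (1 + Polynomial.C Polynomial.X * Polynomial.X) : Polynomial (Polynomial R)) =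
        Polynomial.C (Polynomial.X + Polynomial.C a) *
            (Polynomial.X + Polynomial.C (Polynomial.C b)) +
          Polynomial.C (1 + Polynomial.C (-b) * Polynomial.X) *
            (1 + Polynomial.C (Polynomial.C (-a)) * Polynomial.X) := by
      simp only [map_add, map_mul, map_neg, map_one]
      ring
    rw [h, add_pow]
    refine sum_congr rfl fun r _ => ?_
    simp only [veroneseGen, Polynomial.map_mul, Polynomial.map_pow, Polynomial.map_add,
      Polynomial.map_one, Polynomial.map_C, Polynomial.map_X, map_mul, map_pow, mul_pow]
    ring
  have := congrArg (fun p => (p.coeff j).coeff j) key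
  simp only [Polynomial.finsetSum_coeff, Polynomial.coeff_natCast_mul, Polynomial.coeff_C_mul,
    Polynomial.coeff_map, Polynomial.coeff_mul_C, coeff_one_add_C_mul_X_pow,
    Polynomial.coeff_X_pow_self, mul_one] at this
  exact this

end Krawtchouk

theorem normSq_veroneseSection (n j : ℕ) (z : ℂ) (r : Fin (n + 1)) :
    (normSq (veroneseSection n j z r) : ℂ) =
      ((j.factorial : ℂ) / (1 + (normSq z : ℂ)) ^ j) ^ 2 *
        ((n.choose r : ℂ) * ((veroneseGen z (starRingEnd ℂ z) n r).coeff j *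
          (veroneseGen (starRingEnd ℂ z) z n r).coeff j)) := by
  have hs : ((Real.sqrt (n.choose (r : ℕ)) : ℝ) : ℂ) ^ 2 = (n.choose (r : ℕ) : ℂ) := by
    rw [← ofReal_pow, Real.sq_sqrt (Nat.cast_nonneg _), ofReal_natCast]
  have hc : starRingEnd ℂ ((veroneseGen z (starRingEnd ℂ z) n r).coeff j) =
      (veroneseGen (starRingEnd ℂ z) z n r).coeff j := by
    simp [veroneseGen_coeff]
  rw [← mul_conj, veroneseSection, ← veroneseGen_coeff, map_mul, map_mul, hc, ← hs]
  simp only [map_div₀, map_pow, map_add, map_one, map_natCast, conj_ofReal]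
  ring

theorem sum_normSq_veroneseSection (n j : ℕ) (z : ℂ) :
    ∑ r, normSq (veroneseSection n j z r) =
      ((j.factorial : ℝ) / (1 + normSq z) ^ j) ^ 2 * ((1 + normSq z) ^ n * n.choose j) := by
  apply ofReal_injective
  push_cast
  simp only [normSq_veroneseSection]
  rw [← mul_sum, Fin.sum_univ_eq_sum_range (fun r => (n.choose r : ℂ) *
    ((veroneseGen z (starRingEnd ℂ z) n r).coeff j *
      (veroneseGen (starRingEnd ℂ z) z n r).coeff j)), sum_choose_mul_veroneseGen_coeff, mul_conj]

/-- For `n ≥ 1`, `0 ≤ j ≤ n−1` and `z ∈ ℂ`, the squared norms of consecutive Veronese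
sections satisfy `(1+|z|²)²·‖V̂_{j+1}ⁿ(z)‖² = (j+1)(n−j)·‖V̂ⱼⁿ(z)‖²`; equivalently,
`γⱼⁿ(z) = ‖V̂_{j+1}ⁿ(z)‖²/‖V̂ⱼⁿ(z)‖² = (j+1)(n−j)/(1+|z|²)²`. -/
theorem veronese_section_gamma (n j : ℕ) (hn : 1 ≤ n) (hj : j ≤ n - 1) (z : ℂ) :
    (1 + Complex.normSq z) ^ 2 * ∑ r, Complex.normSq (veroneseSection n (j + 1) z r) =
      (((j + 1) * (n - j) : ℕ) : ℝ) * ∑ r, Complex.normSq (veroneseSection n j z r) := by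
  have hz : 1 + normSq z ≠ 0 := by linarith [normSq_nonneg z]
  have hc : (n.choose (j + 1) : ℝ) * (j + 1) = n.choose j * ((n - j : ℕ) : ℝ) := by
    exact_mod_cast Nat.choose_succ_right_eq n j
  rw [sum_normSq_veroneseSection, sum_normSq_veroneseSection, Nat.factorial_succ]
  generalize 1 + normSq z = x at hz ⊢
  rw [Nat.cast_mul, Nat.cast_mul, Nat.cast_succ, pow_succ x j]
  field_simp
  linear_combination hc
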